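/- Suppose p > 2. Let a8,a9,a10 ∈ F_q^× and b3 ∈ F_q, with λ and χ as follows: λ(t3,t5,t6,t7,t8,t9,t10) = φ(a8·t8 + a9·t9 + a10·t10) on K = {0}×V and χ(x(t)) = φ(b3·t3)·λ^H(x(t)). Then for all t5,t6,t7,t8,t9,t10 ∈ F_q, the value of χ at x(t) with t1 = t2 = t3 = t4 = 0 equals q^3·φ(a8·t8 + a9·t9 + a10·t10) if t5 = t6 = t7 = 0, and equals 0 otherwise. -/

import Mathlib

open Finset
open scoped Classical

noncomputable section

/-- The additive character `φ(x) = exp(2πi·Tr(x)/p)` of `F_q`, where `Tr` is the trace to `F_p`. -/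
def phi (p : ℕ) (F : Type) [Field F] [Fintype F] [Algebra (ZMod p) F] (x : F) : ℂ :=
  Complex.exp (2 * Real.pi * Complex.I * ((Algebra.trace (ZMod p) F x).val : ℂ) / (p : ℂ))

namespace UM11

variable (F : Type) [Field F] [Fintype F]

/- `V = F_q^7` has coordinates `(t3,t5,t6,t7,t8,t9,t10)`, indexed `0,…,6`. -/

/-- `σ1(s) : t5 ↦ t5 − s·t3, t8 ↦ t8 − s·t6, t9 ↦ t9 − s·t7`. -/
def sig1 (s : F) (v : Fin 7 → F) : Fin 7 → F :=
  ![v 0, v 1 - s * v 0, v 2, v 3, v 4 - s * v 2, v 5 - s * v 3, v 6]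

/-- `σ2(s) : t6 ↦ t6 − s·t3, t8 ↦ t8 − s·t5, t10 ↦ t10 − s·t7`. -/
def sig2 (s : F) (v : Fin 7 → F) : Fin 7 → F :=
  ![v 0, v 1, v 2 - s * v 0, v 3, v 4 - s * v 1, v 5, v 6 - s * v 3]

/-- `σ4(s) : t7 ↦ t7 − s·t3, t9 ↦ t9 − s·t5, t10 ↦ t10 − s·t6`. -/
def sig4 (s : F) (v : Fin 7 → F) : Fin 7 → F :=
  ![v 0, v 1, v 2, v 3 - s * v 0, v 4, v 5 - s * v 1, v 6 - s * v 2]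

/-- The composite action `σ1(s1)σ2(s2)σ4(s4)` of `F_q^3` on `V`. -/
def sigma (s : Fin 3 → F) (v : Fin 7 → F) : Fin 7 → F :=
  sig1 F (s 0) (sig2 F (s 1) (sig4 F (s 2) v))

/-- Multiplication in the semidirect product `H = F_q^3 ⋉ V`:
conjugating `(0,v)` by `(s,0)` yields `(0, σ1(s1)σ2(s2)σ4(s4)(v))`. -/
def Hmul (x y : (Fin 3 → F) × (Fin 7 → F)) : (Fin 3 → F) × (Fin 7 → F) :=
  (x.1 + y.1, sigma F y.1 x.2 + y.2)

/-- Inversion in `H`. -/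
def Hinv (x : (Fin 3 → F) × (Fin 7 → F)) : (Fin 3 → F) × (Fin 7 → F) :=
  (-x.1, -(sigma F (-x.1) x.2))

/-- Conjugation `x⁻¹ h x` in `H`. -/
def Hconj (x h : (Fin 3 → F) × (Fin 7 → F)) : (Fin 3 → F) × (Fin 7 → F) :=
  Hmul F (Hmul F (Hinv F x) h) x

/-- The element `x(t) = (0,(t3,0,…,0))·((t1,t2,t4),0)·(0,(0,t5,t6,t7,t8,t9,t10))` of `H`,
for `t = (t1,…,t10)` (indexed `0,…,9`). -/
def xelt (t : Fin 10 → F) : (Fin 3 → F) × (Fin 7 → F) :=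
  Hmul F (Hmul F ((0 : Fin 3 → F), ![t 2, 0, 0, 0, 0, 0, 0]) (![t 0, t 1, t 3], (0 : Fin 7 → F)))
    ((0 : Fin 3 → F), ![0, t 4, t 5, t 6, t 7, t 8, t 9])

/-- The extension by zero `λ̇` to `H` of a function `λ` on `K = {0} × V`. -/
def lamDot (lam : (Fin 7 → F) → ℂ) (h : (Fin 3 → F) × (Fin 7 → F)) : ℂ :=
  if h.1 = 0 then lam h.2 else 0

/-- The induced class function `λ^H(h) = (1/q^7) ∑_{x∈H} λ̇(x⁻¹ h x)`. -/
def ind (lam : (Fin 7 → F) → ℂ) (h : (Fin 3 → F) × (Fin 7 → F)) : ℂ :=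
  (1 / (Fintype.card F : ℂ) ^ 7) * ∑ x : (Fin 3 → F) × (Fin 7 → F), lamDot F lam (Hconj F x h)

end UM11

/-- `phi` as an additive character of `F`. -/
def phiChar (p : ℕ) [NeZero p] (F : Type) [Field F] [Fintype F] [Algebra (ZMod p) F] :
    AddChar F ℂ :=
  (ZMod.stdAddChar (N := p)).compAddMonoidHom (Algebra.trace (ZMod p) F).toAddMonoidHom

theorem phiChar_apply (p : ℕ) [NeZero p] (F : Type) [Field F] [Fintype F] [Algebra (ZMod p) F]
    (x : F) : phiChar p F x = phi p F x := by
  change ZMod.stdAddChar (Algebra.trace (ZMod p) F x) = _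
  rw [ZMod.stdAddChar_apply, ZMod.toCircle_apply, phi]

theorem exists_phiChar_ne_one (p : ℕ) [Fact p.Prime] (F : Type) [Field F] [Fintype F]
    [Algebra (ZMod p) F] : ∃ x, phiChar p F x ≠ 1 := by
  obtain ⟨x, hx⟩ := Algebra.trace_surjective (ZMod p) F 1
  refine ⟨x, fun h => one_ne_zero (α := ZMod p) ?_⟩
  apply ZMod.injective_stdAddChar
  rw [AddChar.map_zero_eq_one, ← h, ← hx]
  rfl

namespace UM11

theorem sigma_sigma_neg_add (F : Type) [Field F] (s : Fin 3 → F)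
    (w v : Fin 7 → F) :
    sigma F s (-(sigma F (-s) w) + v) + w = sigma F s v := by
  ext i
  fin_cases i <;> simp [sigma, sig1, sig2, sig4] <;> ring

theorem sigma_zero (F : Type) [Field F] (v : Fin 7 → F) : sigma F 0 v = v := by
  ext i
  fin_cases i <;> simp [sigma, sig1, sig2, sig4]

theorem Hconj_mk_zero (F : Type) [Field F] (x : (Fin 3 → F) × (Fin 7 → F))
    (v : Fin 7 → F) :
    Hconj F x (0, v) = (0, sigma F x.1 v) := by
  simp [Hconj, Hmul, Hinv, sigma_zero, sigma_sigma_neg_add]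

theorem xelt_eq_mk_zero (F : Type) [Field F] (t3 t5 t6 t7 t8 t9 t10 : F) :
    xelt F ![0, 0, t3, 0, t5, t6, t7, t8, t9, t10] = (0, ![t3, t5, t6, t7, t8, t9, t10]) := by
  ext i <;> fin_cases i <;> simp [xelt, Hmul, sigma, sig1, sig2, sig4]

/-- On `K` the induced class function is the sum of the conjugates under `F_q^3`. -/
theorem ind_mk_zero (F : Type) [Field F] [Fintype F] (lam : (Fin 7 → F) → ℂ)
    (v : Fin 7 → F) :
    ind F lam (0, v) = ∑ s : Fin 3 → F, lam (sigma F s v) := by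
  have hq : (Fintype.card F : ℂ) ≠ 0 := Nat.cast_ne_zero.2 Fintype.card_ne_zero
  simp only [ind, Hconj_mk_zero, lamDot, if_true, Fintype.sum_prod_type, sum_const, card_univ,
    Fintype.card_pi_const, nsmul_eq_mul, ← mul_sum, Nat.cast_pow]
  field_simp

end UM11

/-- Orthogonality: summing a nontrivial character of `F` over the values of a linear form. -/
theorem AddChar.sum_linearMap_eq_ite {F M : Type*} [Field F] [AddCommGroup M] [Module F M]
    [Fintype M] {ψ : AddChar F ℂ} (hψ : ∃ x, ψ x ≠ 1) (L : M →ₗ[F] F) :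
    ∑ m, ψ (L m) = if L = 0 then (Fintype.card M : ℂ) else 0 := by
  split_ifs with h
  · simp [h]
  · have h1 : ψ.compAddMonoidHom L.toAddMonoidHom ≠ 0 := by
      obtain ⟨x, hx⟩ := hψ
      obtain ⟨m, rfl⟩ := LinearMap.surjective h x
      exact fun h0 => hx (DFunLike.congr_fun h0 m)
    simpa using AddChar.sum_eq_zero_iff_ne_zero.2 h1

theorem eq_zero_of_pairwise_relations {F : Type*} [Field F] (h2 : (2 : F) ≠ 0)
    {a b c x y z : F} (ha : a ≠ 0) (hb : b ≠ 0) (hc : c ≠ 0) (h1 : a * y + b * z = 0)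
    (h3 : a * x + c * z = 0) (h4 : b * x + c * y = 0) : x = 0 ∧ y = 0 ∧ z = 0 := by
  have hx : (2 * a * b) * x = 0 := by linear_combination b * h3 + a * h4 - c * h1
  obtain rfl : x = 0 := by simpa [h2, ha, hb] using hx
  simp_all

open UM11 in
/-- for `p > 2`, the value of `χ(x(t)) = φ(b3·t3)·λ^H(x(t))` at `x(t)` with
`t1 = t2 = t3 = t4 = 0` is `q³·φ(a8·t8 + a9·t9 + a10·t10)` if `t5 = t6 = t7 = 0`, else `0`. -/
theorem stmt9 (p : ℕ) [Fact p.Prime] (hp : 2 < p) (F : Type) [Field F] [Fintype F] [CharP F p]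
    [Algebra (ZMod p) F] (a8 a9 a10 : F) (h8 : a8 ≠ 0) (h9 : a9 ≠ 0) (h10 : a10 ≠ 0)
    (b3 : F) (t5 t6 t7 t8 t9 t10 : F) :
    phi p F (b3 * (0 : F)) *
      ind F (fun v => phi p F (a8 * v 4 + a9 * v 5 + a10 * v 6))
        (xelt F ![0, 0, 0, 0, t5, t6, t7, t8, t9, t10]) =
    if t5 = 0 ∧ t6 = 0 ∧ t7 = 0 then
      (Fintype.card F : ℂ) ^ 3 * phi p F (a8 * t8 + a9 * t9 + a10 * t10)
    else 0 := by
  have h2 : (2 : F) ≠ 0 := Ring.two_ne_zero (by rw [ringChar.eq F p]; exact hp.ne')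
  let L : (Fin 3 → F) →ₗ[F] F := Fintype.linearCombination F
    ![-(a8 * t6 + a9 * t7), -(a8 * t5 + a10 * t7), -(a9 * t5 + a10 * t6)]
  have hL (s : Fin 3 → F) : L s = s 0 * -(a8 * t6 + a9 * t7) + s 1 * -(a8 * t5 + a10 * t7) +
      s 2 * -(a9 * t5 + a10 * t6) := by
    simp [L, Fintype.linearCombination_apply, Fin.sum_univ_three]
  have hL0 : L = 0 ↔ t5 = 0 ∧ t6 = 0 ∧ t7 = 0 := by
    refine ⟨fun h => ?_, ?_⟩
    · have h1 := hL ![1, 0, 0]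
      have h3 := hL ![0, 1, 0]
      have h4 := hL ![0, 0, 1]
      simp only [h, LinearMap.zero_apply, Matrix.cons_val] at h1 h3 h4
      exact eq_zero_of_pairwise_relations h2 h8 h9 h10 (by linear_combination h1)
        (by linear_combination h3) (by linear_combination h4)
    · rintro ⟨rfl, rfl, rfl⟩
      exact LinearMap.ext fun s => by simp [hL]
  have hterm (s : Fin 3 → F) :
      phiChar p F (a8 * sigma F s ![0, t5, t6, t7, t8, t9, t10] 4 +
        a9 * sigma F s ![0, t5, t6, t7, t8, t9, t10] 5 +
        a10 * sigma F s ![0, t5, t6, t7, t8, t9, t10] 6) =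
      phiChar p F (a8 * t8 + a9 * t9 + a10 * t10) * phiChar p F (L s) := by
    rw [← AddChar.map_add_eq_mul, hL]
    congr 1
    simp [sigma, sig1, sig2, sig4]
    ring
  rw [xelt_eq_mk_zero, ind_mk_zero]
  simp only [← phiChar_apply, hterm]
  rw [← mul_sum, AddChar.sum_linearMap_eq_ite (exists_phiChar_ne_one p F), mul_zero,
    AddChar.map_zero_eq_one, one_mul]
  simp only [hL0, mul_ite, mul_zero, Fintype.card_pi_const, Nat.cast_pow]
  simp only [mul_comm]
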